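/- (Theorem 1, Connection between two symbols) Let m ∈ ℝ, 0 < ρ ≤ 1, 0 ≤ δ ≤ 1. A function ã : ℝⁿ × ℤⁿ → ℂ, 1-periodic and smooth in x for each fixed ξ ∈ ℤⁿ, satisfies the toroidal symbol estimates |Δ_ξ^α ∂_x^β ã(x, ξ)| ≤ c_{αβ} (1 + ‖ξ‖²)^{(m - ρ|α| + δ|β|)/2} for all multi-indices α, β, all x ∈ ℝⁿ and ξ ∈ ℤⁿ, if and only if there exists a smooth function a : ℝⁿ × ℝⁿ → ℂ, 1-periodic in each coordinate of x, satisfying the Euclidean symbol estimates |∂_x^β ∂_ξ^α a(x, ξ)| ≤ c'_{αβ} (1 + ‖ξ‖²)^{(m - ρ|α| + δ|β|)/2} for all multi-indices α, β and all x, ξ ∈ ℝⁿ, such that ã(x, ξ) = a(x, ξ) for all x ∈ ℝⁿ and ξ ∈ ℤⁿ. -/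

import Mathlib

/-- The partial derivative in the `i`-th coordinate. -/
noncomputable def pDeriv {n : ℕ} {E : Type*} [NormedAddCommGroup E] [NormedSpace ℝ E]
    (i : Fin n) (f : (Fin n → ℝ) → E) : (Fin n → ℝ) → E :=
  fun x => deriv (fun t => f (Function.update x i t)) (x i)

/-- Iterated partial derivative `∂^α = ∂₁^{α 1} ⋯ ∂ₙ^{α n}` for a multi-index `α`. -/
noncomputable def mDeriv {n : ℕ} {E : Type*} [NormedAddCommGroup E] [NormedSpace ℝ E]
    (α : Fin n → ℕ) (f : (Fin n → ℝ) → E) : (Fin n → ℝ) → E :=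
  (List.finRange n).foldr (fun i g => (pDeriv i)^[α i] g) f

/-- The mixed derivative `∂_x^β ∂_ξ^α a(x, ξ)` of a function of two variables. -/
noncomputable def mixedDeriv {n : ℕ} {E : Type*} [NormedAddCommGroup E] [NormedSpace ℝ E]
    (β α : Fin n → ℕ) (a : (Fin n → ℝ) → (Fin n → ℝ) → E) :
    (Fin n → ℝ) → (Fin n → ℝ) → E :=
  fun x ξ => mDeriv β (fun x' => mDeriv α (a x') ξ) x

/-- The forward difference operator in the `i`-th frequency variable:
`(Δ^{e_i} g)(ξ) = g(ξ + e_i) - g(ξ)` for `g : ℤⁿ → E`. -/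
def fwdDiffInt {n : ℕ} {E : Type*} [AddCommGroup E]
    (i : Fin n) (g : (Fin n → ℤ) → E) : (Fin n → ℤ) → E :=
  fun ξ => g (Function.update ξ i (ξ i + 1)) - g ξ

/-- Iterated forward difference `Δ^α = (Δ^{e_1})^{α 1} ⋯ (Δ^{e_n})^{α n}`. -/
def mFwdDiff {n : ℕ} {E : Type*} [AddCommGroup E]
    (α : Fin n → ℕ) (g : (Fin n → ℤ) → E) : (Fin n → ℤ) → E :=
  (List.finRange n).foldr (fun i h => (fwdDiffInt i)^[α i] h) g

section Kernel

open Real Set MeasureTheory Filter Topology FourierTransform SchwartzMap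

/-- A smooth transition from `0` to `1` that is constant outside `[1/4, 3/4]`. -/
noncomputable def stepProfile (x : ℝ) : ℝ := Real.smoothTransition (2 * x - 1 / 2)

/-- A smooth function supported in `[-3/4, 3/4]` whose integer translates sum to `1`. -/
noncomputable def unityProfile (x : ℝ) : ℝ := stepProfile (x + 1) - stepProfile x

lemma contDiff_unityProfile : ContDiff ℝ (⊤ : ℕ∞) unityProfile := by
  unfold unityProfile stepProfile
  exact (Real.smoothTransition.contDiff.comp (by fun_prop)).sub
    (Real.smoothTransition.contDiff.comp (by fun_prop))

lemma stepProfile_of_le {x : ℝ} (hx : x ≤ 1 / 4) : stepProfile x = 0 :=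
  Real.smoothTransition.zero_of_nonpos (by linarith)

lemma stepProfile_of_ge {x : ℝ} (hx : 3 / 4 ≤ x) : stepProfile x = 1 :=
  Real.smoothTransition.one_of_one_le (by linarith)

lemma unityProfile_eq_zero {x : ℝ} (hx : 3 / 4 ≤ |x|) : unityProfile x = 0 := by
  unfold unityProfile
  rcases le_abs'.1 hx with h | h
  · rw [stepProfile_of_le (by linarith), stepProfile_of_le (by linarith), sub_zero]
  · rw [stepProfile_of_ge (by linarith), stepProfile_of_ge (by linarith), sub_self]

/-- The entire function with `diffQuot z * (-2πi z) = exp (-2πi z) - 1`. -/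
noncomputable def diffQuot (z : ℂ) : ℂ :=
  dslope (fun z : ℂ => Complex.exp (-2 * π * Complex.I * z)) 0 z / (-2 * π * Complex.I)

lemma diffQuot_mul (z : ℂ) :
    diffQuot z * (-2 * π * Complex.I * z) = Complex.exp (-2 * π * Complex.I * z) - 1 := by
  have h := sub_smul_dslope (fun z : ℂ => Complex.exp (-2 * π * Complex.I * z)) 0 z
  simp only [sub_zero, smul_eq_mul, mul_zero, Complex.exp_zero] at h
  rw [← h, diffQuot]
  have : (π : ℂ) ≠ 0 := by exact_mod_cast Real.pi_ne_zero
  field_simp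

lemma diffQuot_zero : diffQuot 0 = 1 := by
  have hd : HasDerivAt (fun z : ℂ => Complex.exp (-2 * π * Complex.I * z))
      (-2 * π * Complex.I) 0 := by
    have := ((hasDerivAt_id (0 : ℂ)).const_mul (-2 * π * Complex.I)).cexp
    simpa using this
  rw [diffQuot, dslope_same, hd.deriv, div_self]
  simp [Real.pi_ne_zero]

lemma diffQuot_ne_zero {x : ℝ} (hx : |x| < 1) : diffQuot x ≠ 0 := by
  intro h0
  have h := diffQuot_mul x
  rw [h0, zero_mul, eq_comm, sub_eq_zero, Complex.exp_eq_one_iff] at h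
  obtain ⟨k, hk⟩ := h
  have h2 : (2 * π * Complex.I) ≠ 0 := Complex.two_pi_I_ne_zero
  have : (x : ℂ) = ((-k : ℤ) : ℂ) := by
    apply mul_left_cancel₀ h2
    push_cast
    linear_combination -hk
  have hxk : x = ((-k : ℤ) : ℝ) := by exact_mod_cast this
  have : |(-k : ℤ)| < 1 := by
    rw [hxk] at hx
    exact_mod_cast hx
  rw [Int.abs_lt_one_iff.1 this] at hxk
  rw [hxk] at h0
  simp [diffQuot_zero] at h0

lemma contDiff_diffQuot : ContDiff ℝ (⊤ : ℕ∞) (fun x : ℝ => diffQuot x) := by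
  have hd : Differentiable ℂ diffQuot := by
    apply Differentiable.div_const
    rw [← differentiableOn_univ, Complex.differentiableOn_dslope univ_mem]
    fun_prop
  exact (hd.contDiff.restrict_scalars ℝ).comp Complex.ofRealCLM.contDiff

/-- The Fourier-side profiles `unityProfile / diffQuot ^ k`. -/
noncomputable def kernelProfile (k : ℕ) (x : ℝ) : ℂ := unityProfile x / diffQuot x ^ k

lemma kernelProfile_eq_zero {k : ℕ} {x : ℝ} (hx : 3 / 4 ≤ |x|) : kernelProfile k x = 0 := by
  simp [kernelProfile, unityProfile_eq_zero hx]

lemma hasCompactSupport_kernelProfile (k : ℕ) : HasCompactSupport (kernelProfile k) := by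
  apply HasCompactSupport.intro (isCompact_Icc (a := (-1 : ℝ)) (b := 1))
  intro x hx
  apply kernelProfile_eq_zero
  by_contra h
  have := abs_lt.1 (not_le.1 h)
  exact hx ⟨by linarith, by linarith⟩

lemma contDiff_kernelProfile (k : ℕ) : ContDiff ℝ (⊤ : ℕ∞) (kernelProfile k) := by
  rw [contDiff_iff_contDiffAt]
  intro x
  by_cases hx : |x| < 1
  · simp only [div_eq_mul_inv, funext fun x => kernelProfile.eq_def k x]
    exact (Complex.ofRealCLM.contDiff.comp contDiff_unityProfile).contDiffAt.mul
      ((contDiff_diffQuot.pow k).contDiffAt.inv (pow_ne_zero _ (diffQuot_ne_zero hx)))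
  · have : kernelProfile k =ᶠ[𝓝 x] fun _ => 0 := by
      filter_upwards [continuous_abs.continuousAt.eventually
        (lt_mem_nhds (show 3 / 4 < |x| by linarith))] with y hy
      exact kernelProfile_eq_zero hy.le
    exact contDiffAt_const.congr_of_eventuallyEq this

lemma kernelProfile_succ (k : ℕ) (x : ℝ) :
    (Complex.exp (-2 * π * Complex.I * x) - 1) * kernelProfile (k + 1) x =
      -2 * π * Complex.I * x * kernelProfile k x := by
  by_cases hx : |x| < 1
  · have := diffQuot_ne_zero hx
    rw [← diffQuot_mul, kernelProfile, kernelProfile]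
    field_simp
    ring
  · have h : 3 / 4 ≤ |x| := by linarith
    simp [kernelProfile_eq_zero h]

/-- `kernelProfile k` as a Schwartz function. -/
noncomputable def kernelSchwartz (k : ℕ) : 𝓢(ℝ, ℂ) :=
  (hasCompactSupport_kernelProfile k).toSchwartzMap (contDiff_kernelProfile k)

/-- The one-dimensional interpolation kernels. -/
noncomputable def interpKernel (k : ℕ) : ℝ → ℂ := ⇑(𝓕 (kernelSchwartz k) : 𝓢(ℝ, ℂ))

lemma interpKernel_eq_integral (k : ℕ) (t : ℝ) :
    interpKernel k t = ∫ x : ℝ, Complex.exp (-2 * π * Complex.I * (x * t)) * kernelProfile k x := by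
  have : interpKernel k t = 𝓕 (kernelProfile k) t := rfl
  rw [this, Real.fourier_real_eq_integral_exp_smul]
  congr 1 with x
  rw [smul_eq_mul]
  congr 2
  push_cast
  ring

lemma integrable_kernelProfile (k : ℕ) : Integrable (kernelProfile k) :=
  (contDiff_kernelProfile k).continuous.integrable_of_hasCompactSupport
    (hasCompactSupport_kernelProfile k)

lemma integrable_exp_mul_kernelProfile (k : ℕ) (t : ℝ) :
    Integrable fun x : ℝ => Complex.exp (-2 * π * Complex.I * (x * t)) * kernelProfile k x := by
  have hc := (contDiff_kernelProfile k).continuous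
  exact Continuous.integrable_of_hasCompactSupport (by fun_prop)
    (hasCompactSupport_kernelProfile k).mul_left

lemma hasDerivAt_interpKernel (k : ℕ) (t : ℝ) :
    HasDerivAt (interpKernel k) (interpKernel (k + 1) (t + 1) - interpKernel (k + 1) t) t := by
  have hc := (contDiff_kernelProfile k).continuous
  have h : HasDerivAt (interpKernel k)
      (𝓕 (fun x : ℝ => (-2 * π * Complex.I * x) • kernelProfile k x) t) t :=
    Real.hasDerivAt_fourier (integrable_kernelProfile k)
      (Continuous.integrable_of_hasCompactSupport (by fun_prop)
        (hasCompactSupport_kernelProfile k).smul_left) t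
  convert! h using 1
  rw [interpKernel_eq_integral, interpKernel_eq_integral,
    ← integral_sub (integrable_exp_mul_kernelProfile _ _) (integrable_exp_mul_kernelProfile _ _),
    Real.fourier_real_eq_integral_exp_smul]
  congr 1 with x
  rw [smul_eq_mul, smul_eq_mul, ← kernelProfile_succ]
  have h1 : Complex.exp (-2 * π * Complex.I * (x * ((t + 1 : ℝ) : ℂ))) =
      Complex.exp (-2 * π * Complex.I * (x * t)) * Complex.exp (-2 * π * Complex.I * x) := by
    rw [← Complex.exp_add]
    congr 1
    push_cast
    ring
  have h2 : Complex.exp (((-2 * π * x * t : ℝ) : ℂ) * Complex.I) =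
      Complex.exp (-2 * π * Complex.I * (x * t)) := by
    congr 1
    push_cast
    ring
  rw [h1, h2]
  ring

lemma interpKernel_decay (k N : ℕ) :
    ∃ C : ℝ, 0 ≤ C ∧ ∀ t : ℝ, ‖interpKernel k t‖ ≤ C * ((1 + t ^ 2) ^ N)⁻¹ := by
  obtain ⟨C₀, h₀⟩ := (𝓕 (kernelSchwartz k) : 𝓢(ℝ, ℂ)).decay 0 0
  obtain ⟨C₁, h₁⟩ := (𝓕 (kernelSchwartz k) : 𝓢(ℝ, ℂ)).decay (2 * N) 0
  simp only [norm_iteratedFDeriv_zero, pow_zero, one_mul] at h₀ h₁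
  have hC₀ : 0 ≤ C₀ := (norm_nonneg _).trans (h₀.2 0)
  have hC₁ : 0 ≤ C₁ := le_trans (by positivity) (h₁.2 0)
  refine ⟨2 ^ N * (C₀ + C₁), by positivity, fun t => ?_⟩
  rw [← div_eq_mul_inv, le_div_iff₀ (by positivity)]
  have h0 := h₀.2 t
  have h1 := h₁.2 t
  change ‖interpKernel k t‖ ≤ C₀ at h0
  change ‖t‖ ^ (2 * N) * ‖interpKernel k t‖ ≤ C₁ at h1
  rw [pow_mul, Real.norm_eq_abs, sq_abs] at h1
  have hp : (1 + t ^ 2) ^ N ≤ 2 ^ N * (1 + (t ^ 2) ^ N) := by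
    have h2 : (1 + t ^ 2) ^ N ≤ (2 * max 1 (t ^ 2)) ^ N := by
      gcongr
      linarith [le_max_left 1 (t ^ 2), le_max_right 1 (t ^ 2)]
    refine h2.trans ?_
    rw [mul_pow]
    gcongr
    rcases max_choice 1 (t ^ 2) with h | h <;> rw [h]
    · rw [one_pow]
      linarith [pow_nonneg (sq_nonneg t) N]
    · linarith
  calc ‖interpKernel k t‖ * (1 + t ^ 2) ^ N
      ≤ ‖interpKernel k t‖ * (2 ^ N * (1 + (t ^ 2) ^ N)) := by gcongr
    _ = 2 ^ N * (‖interpKernel k t‖ + (t ^ 2) ^ N * ‖interpKernel k t‖) := by ring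
    _ ≤ 2 ^ N * (C₀ + C₁) := by gcongr

lemma interpKernel_zero_int (j : ℤ) : interpKernel 0 j = if j = 0 then 1 else 0 := by
  have hc : Continuous stepProfile := by
    unfold stepProfile
    exact Real.smoothTransition.continuous.comp (by fun_prop)
  have hcu : Continuous unityProfile := contDiff_unityProfile.continuous
  set e : ℝ → ℂ := fun x => Complex.exp (-2 * π * Complex.I * (x * (j : ℝ))) with he
  have hec : Continuous e := by fun_prop
  have heper : ∀ x : ℝ, e (x + -1) = e x := by
    intro x
    rw [he]
    dsimp only
    rw [Complex.exp_eq_exp_iff_exists_int]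
    refine ⟨j, ?_⟩
    push_cast
    ring
  have h1 : interpKernel 0 j = ∫ x in (-1 : ℝ)..1, e x * unityProfile x := by
    rw [interpKernel_eq_integral, intervalIntegral.integral_of_le (by norm_num),
      setIntegral_eq_integral_of_forall_compl_eq_zero]
    · simp [kernelProfile, he]
    · intro x hx
      rw [unityProfile_eq_zero, Complex.ofReal_zero, mul_zero]
      by_contra h
      have := abs_lt.1 (not_le.1 h)
      exact hx ⟨by linarith, by linarith⟩
  have hint : ∀ a b : ℝ, IntervalIntegrable (fun x => e x * unityProfile x) volume a b :=
    fun a b => Continuous.intervalIntegrable (by fun_prop) _ _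
  rw [h1, ← intervalIntegral.integral_add_adjacent_intervals (hint (-1) 0) (hint 0 1)]
  have h2 : ∫ x in (-1 : ℝ)..0, e x * unityProfile x =
      ∫ x in (0 : ℝ)..1, e x * unityProfile (x + -1) := by
    have := intervalIntegral.integral_comp_add_right (a := 0) (b := 1)
      (fun x => e x * unityProfile x) (-1 : ℝ)
    simp only [heper] at this
    rw [this]
    norm_num
  rw [h2, ← intervalIntegral.integral_add
    (Continuous.intervalIntegrable (by fun_prop) _ _) (hint 0 1)]
  have h3 : ∫ x in (0 : ℝ)..1, (e x * unityProfile (x + -1) + e x * unityProfile x) =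
      ∫ x in (0 : ℝ)..1, e x := by
    apply intervalIntegral.integral_congr
    intro x hx
    rw [uIcc_of_le zero_le_one] at hx
    have a1 : unityProfile (x + -1) + unityProfile x = 1 := by
      unfold unityProfile
      rw [neg_add_cancel_right, stepProfile_of_ge (x := x + 1) (by linarith [hx.1]),
        stepProfile_of_le (x := x + -1) (by linarith [hx.2])]
      ring
    dsimp only
    rw [← mul_add, ← Complex.ofReal_add, a1, Complex.ofReal_one, mul_one]
  rw [h3]
  split_ifs with hj
  · simp [he, hj]
  · have hne : (-2 * π * Complex.I * j : ℂ) ≠ 0 := by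
      simp [Real.pi_ne_zero, hj]
    have h4 : ∀ x : ℝ, e x = Complex.exp ((-2 * π * Complex.I * j) * x) := by
      intro x
      rw [he]
      dsimp only
      congr 1
      push_cast
      ring
    simp only [h4]
    rw [integral_exp_mul_complex hne]
    have h5 : Complex.exp (-2 * π * Complex.I * j * (1 : ℝ)) = 1 := by
      rw [Complex.exp_eq_one_iff]
      refine ⟨-j, ?_⟩
      push_cast
      ring
    rw [h5]
    simp

end Kernel

section Weight

/-- The squared Japanese bracket `1 + |ξ|²`. -/
noncomputable def japSq {n : ℕ} (ξ : Fin n → ℝ) : ℝ := 1 + ∑ i, ξ i ^ 2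

/-- The inclusion of the integer lattice. -/
def latticePoint {n : ℕ} (η : Fin n → ℤ) : Fin n → ℝ := fun i => (η i : ℝ)

variable {n : ℕ}

lemma one_le_japSq (ξ : Fin n → ℝ) : 1 ≤ japSq ξ :=
  le_add_of_nonneg_right (Finset.sum_nonneg fun _ _ => sq_nonneg _)

lemma japSq_pos (ξ : Fin n → ℝ) : 0 < japSq ξ := zero_lt_one.trans_le (one_le_japSq ξ)

lemma japSq_neg (ξ : Fin n → ℝ) : japSq (-ξ) = japSq ξ := by simp [japSq]

lemma japSq_add_le (s t : Fin n → ℝ) : japSq (s + t) ≤ 2 * japSq t * japSq s := by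
  have h : ∑ i, (s + t) i ^ 2 ≤ 2 * ∑ i, s i ^ 2 + 2 * ∑ i, t i ^ 2 := by
    rw [Finset.mul_sum, Finset.mul_sum, ← Finset.sum_add_distrib]
    refine Finset.sum_le_sum fun i _ => ?_
    rw [Pi.add_apply]
    nlinarith [sq_nonneg (s i - t i)]
  have hs : 0 ≤ ∑ i, s i ^ 2 := Finset.sum_nonneg fun _ _ => sq_nonneg _
  have ht : 0 ≤ ∑ i, t i ^ 2 := Finset.sum_nonneg fun _ _ => sq_nonneg _
  unfold japSq
  nlinarith [mul_nonneg hs ht]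

/-- Peetre's inequality. -/
lemma japSq_add_rpow_le (s t : Fin n → ℝ) (r : ℝ) :
    japSq (s + t) ^ r ≤ (2 * japSq t) ^ |r| * japSq s ^ r := by
  have ht := japSq_pos t
  rcases le_total 0 r with hr | hr
  · rw [abs_of_nonneg hr, ← Real.mul_rpow (by positivity) (japSq_pos s).le]
    exact Real.rpow_le_rpow (japSq_pos _).le (japSq_add_le s t) hr
  · have h : japSq s ≤ 2 * japSq t * japSq (s + t) := by
      simpa [japSq_neg] using japSq_add_le (s + t) (-t)
    rw [abs_of_nonpos hr, Real.rpow_neg (by positivity), ← div_eq_inv_mul,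
      le_div_iff₀ (Real.rpow_pos_of_pos (by positivity) _), mul_comm,
      ← Real.mul_rpow (by positivity) (japSq_pos _).le]
    exact Real.rpow_le_rpow_of_nonpos (japSq_pos s) h hr

lemma japSq_single_le (i : Fin n) {t : ℝ} (ht : |t| ≤ 1) : japSq (Pi.single i t) ≤ 2 := by
  have : ∑ j, (Pi.single i t : Fin n → ℝ) j ^ 2 = t ^ 2 := by
    rw [Finset.sum_eq_single i] <;> simp +contextual
  rw [japSq, this]
  nlinarith [abs_le.1 ht, sq_abs t, abs_nonneg t]

lemma japSq_add_single_rpow_le (s : Fin n → ℝ) (i : Fin n) {t : ℝ} (ht : |t| ≤ 1) (r : ℝ) :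
    japSq (s + Pi.single i t) ^ r ≤ 4 ^ |r| * japSq s ^ r := by
  refine (japSq_add_rpow_le s _ r).trans ?_
  gcongr
  · exact Real.rpow_nonneg (japSq_pos s).le _
  · have := japSq_pos (Pi.single i t : Fin n → ℝ)
    linarith
  · linarith [japSq_single_le i ht]

lemma japSq_le_prod (ξ : Fin n → ℝ) : japSq ξ ≤ ∏ i, (1 + ξ i ^ 2) := by
  have : ∀ s : Finset (Fin n), 1 + ∑ i ∈ s, ξ i ^ 2 ≤ ∏ i ∈ s, (1 + ξ i ^ 2) := by
    intro s
    induction s using Finset.induction_on with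
    | empty => simp
    | insert a s ha ih =>
      rw [Finset.sum_insert ha, Finset.prod_insert ha]
      have hs : 0 ≤ ∑ i ∈ s, ξ i ^ 2 := Finset.sum_nonneg fun _ _ => sq_nonneg _
      nlinarith [mul_nonneg (sq_nonneg (ξ a)) hs, sq_nonneg (ξ a),
        mul_le_mul_of_nonneg_left ih (sq_nonneg (ξ a))]
  exact this Finset.univ

lemma prod_le_japSq_pow (ξ : Fin n → ℝ) : ∏ i, (1 + ξ i ^ 2) ≤ japSq ξ ^ n := by
  calc ∏ i, (1 + ξ i ^ 2) ≤ ∏ _i : Fin n, japSq ξ := by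
        refine Finset.prod_le_prod (fun i _ => by positivity) fun i _ => ?_
        unfold japSq
        gcongr
        exact Finset.single_le_sum (f := fun i => ξ i ^ 2) (fun j _ => sq_nonneg _)
          (Finset.mem_univ i)
    _ = japSq ξ ^ n := by simp

lemma summable_pi_prod_of_nonneg {ι κ : Type*} [Fintype ι] [DecidableEq ι] {g : κ → ℝ}
    (hg : ∀ k, 0 ≤ g k) (hs : Summable g) : Summable fun η : ι → κ => ∏ i, g (η i) := by
  classical
  refine summable_of_sum_le (c := ∏ _i : ι, ∑' k, g k)
    (fun η => Finset.prod_nonneg fun i _ => hg _) fun s => ?_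
  have hsub : s ⊆ Fintype.piFinset fun i => s.image fun η => η i := by
    intro η hη
    exact Fintype.mem_piFinset.2 fun i => Finset.mem_image_of_mem _ hη
  calc ∑ η ∈ s, ∏ i, g (η i)
      ≤ ∑ η ∈ Fintype.piFinset fun i => s.image fun η => η i, ∏ i, g (η i) :=
        Finset.sum_le_sum_of_subset_of_nonneg hsub
          fun η _ _ => Finset.prod_nonneg fun i _ => hg _
    _ = ∏ i, ∑ k ∈ s.image fun η => η i, g k := (Finset.prod_univ_sum _ _).symm
    _ ≤ ∏ _i : ι, ∑' k, g k := Finset.prod_le_prod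
        (fun i _ => Finset.sum_nonneg fun k _ => hg k)
        fun i _ => hs.sum_le_tsum _ fun k _ => hg k

lemma summable_japSq_lattice :
    Summable fun η : Fin n → ℤ => japSq (latticePoint η) ^ (-(n : ℝ)) := by
  have h1 : Summable fun k : ℤ => (1 + (k : ℝ) ^ 2)⁻¹ := by
    refine Summable.of_nonneg_of_le (fun k => by positivity) (fun k => ?_)
      (((Real.summable_one_div_int_pow (p := 2)).2 (by norm_num)).add
        (summable_of_ne_finset_zero (f := fun k : ℤ => if k = 0 then (1 : ℝ) else 0)
          (s := {0}) (by simp +contextual)))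
    by_cases hk : k = 0
    · simp [hk]
    · have : (0 : ℝ) < (k : ℝ) ^ 2 := by positivity
      simp only [hk, if_false, add_zero, one_div]
      gcongr
      linarith
  refine Summable.of_nonneg_of_le (fun η => Real.rpow_nonneg (japSq_pos _).le _) (fun η => ?_)
    (summable_pi_prod_of_nonneg (ι := Fin n) (fun k : ℤ => by positivity) h1)
  rw [Real.rpow_neg (japSq_pos _).le, Real.rpow_natCast, Finset.prod_inv_distrib]
  have hp : 0 < ∏ i, (1 + (η i : ℝ) ^ 2) := Finset.prod_pos fun i _ => by positivity
  exact inv_anti₀ hp (prod_le_japSq_pow (latticePoint η))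

/-- The lattice sums of `⟨ξ - η⟩^(-2n)` are bounded uniformly in `ξ`. -/
lemma exists_tsum_japSq_sub_le :
    ∃ C : ℝ, 0 ≤ C ∧ ∀ ξ : Fin n → ℝ,
      Summable (fun η : Fin n → ℤ => japSq (ξ - latticePoint η) ^ (-(n : ℝ))) ∧
      ∑' η : Fin n → ℤ, japSq (ξ - latticePoint η) ^ (-(n : ℝ)) ≤ C := by
  have hS := summable_japSq_lattice (n := n)
  set B : ℝ := (2 * (2 : ℝ) ^ n) ^ (n : ℝ) with hB
  refine ⟨∑' η : Fin n → ℤ, B * japSq (latticePoint η) ^ (-(n : ℝ)),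
    tsum_nonneg fun η => mul_nonneg (by positivity) (Real.rpow_nonneg (japSq_pos _).le _),
    fun ξ => ?_⟩
  have hle : ∀ η : Fin n → ℤ,
      japSq (ξ - latticePoint ((Equiv.subLeft fun i => ⌊ξ i⌋) η)) ^ (-(n : ℝ)) ≤
        B * japSq (latticePoint η) ^ (-(n : ℝ)) := by
    intro η
    have h1 : ξ - latticePoint ((Equiv.subLeft fun i => ⌊ξ i⌋) η) =
        latticePoint η + fun i => Int.fract (ξ i) := by
      ext i
      simp only [latticePoint, Pi.sub_apply, Pi.add_apply, Equiv.subLeft_apply, Int.fract]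
      push_cast
      ring
    rw [h1]
    refine (japSq_add_rpow_le _ _ _).trans ?_
    rw [abs_neg, abs_of_nonneg (Nat.cast_nonneg n), hB]
    have h2 : japSq (fun i => Int.fract (ξ i)) ≤ 2 ^ n := by
      refine (japSq_le_prod _).trans ?_
      calc ∏ i, (1 + Int.fract (ξ i) ^ 2) ≤ ∏ _i : Fin n, (2 : ℝ) := by
            refine Finset.prod_le_prod (fun i _ => by positivity) fun i _ => ?_
            nlinarith [Int.fract_nonneg (ξ i), Int.fract_lt_one (ξ i)]
        _ = 2 ^ n := by simp
    have h3 := japSq_pos fun i => Int.fract (ξ i)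
    gcongr
    exact Real.rpow_nonneg (japSq_pos _).le _
  have hs : Summable fun η : Fin n → ℤ =>
      japSq (ξ - latticePoint ((Equiv.subLeft fun i => ⌊ξ i⌋) η)) ^ (-(n : ℝ)) :=
    Summable.of_nonneg_of_le (fun η => Real.rpow_nonneg (japSq_pos _).le _) hle (hS.mul_left B)
  constructor
  · exact (Equiv.subLeft fun i => ⌊ξ i⌋).summable_iff.1 hs
  · rw [← (Equiv.subLeft fun i => ⌊ξ i⌋).tsum_eq]
    exact hs.tsum_le_tsum hle (hS.mul_left B)

end Weight

section Derivatives

variable {n : ℕ}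

/-- The list in which each index `i` occurs `α i` times. -/
def indexList (α : Fin n → ℕ) : List (Fin n) :=
  (List.finRange n).flatMap fun i => List.replicate (α i) i

/-- Iterated partial derivatives along a list of indices. -/
noncomputable def listDeriv {E : Type*} [NormedAddCommGroup E] [NormedSpace ℝ E]
    (L : List (Fin n)) (f : (Fin n → ℝ) → E) : (Fin n → ℝ) → E :=
  L.foldr pDeriv f

/-- Iterated forward differences along a list of indices. -/
def listDiff {E : Type*} [AddCommGroup E] (L : List (Fin n)) (g : (Fin n → ℤ) → E) :
    (Fin n → ℤ) → E :=
  L.foldr fwdDiffInt g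

lemma foldr_indexList {β : Type*} (op : Fin n → β → β) (α : Fin n → ℕ) (b : β) :
    (indexList α).foldr op b = (List.finRange n).foldr (fun i c => (op i)^[α i] c) b := by
  rw [indexList, List.foldr_flatMap]
  congr 1
  funext i c
  induction α i with
  | zero => rfl
  | succ k ih => rw [List.replicate_succ, List.foldr_cons, ih, Function.iterate_succ_apply']

lemma mDeriv_eq_listDeriv {E : Type*} [NormedAddCommGroup E] [NormedSpace ℝ E]
    (α : Fin n → ℕ) (f : (Fin n → ℝ) → E) : mDeriv α f = listDeriv (indexList α) f :=
  (foldr_indexList pDeriv α f).symm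

lemma mFwdDiff_eq_listDiff {E : Type*} [AddCommGroup E]
    (α : Fin n → ℕ) (g : (Fin n → ℤ) → E) : mFwdDiff α g = listDiff (indexList α) g :=
  (foldr_indexList fwdDiffInt α g).symm

lemma perm_indexList_count (L : List (Fin n)) : (indexList fun i => L.count i).Perm L := by
  rw [List.perm_iff_count]
  intro a
  rw [indexList, List.count_flatMap]
  simp only [Function.comp_def, List.count_replicate, beq_iff_eq]
  rw [← List.ofFn_eq_map, List.sum_ofFn]
  simp

/-- Iterated directional derivatives along a list of vectors. -/
noncomputable def dirDeriv {V E : Type*} [NormedAddCommGroup V] [NormedSpace ℝ V]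
    [NormedAddCommGroup E] [NormedSpace ℝ E] (l : List V) (F : V → E) : V → E :=
  l.foldr (fun v f p => fderiv ℝ f p v) F

section DirDeriv

variable {V E : Type*} [NormedAddCommGroup V] [NormedSpace ℝ V]
  [NormedAddCommGroup E] [NormedSpace ℝ E]

lemma ContDiff.fderiv_apply_const {F : V → E} (hF : ContDiff ℝ (⊤ : ℕ∞) F) (v : V) :
    ContDiff ℝ (⊤ : ℕ∞) fun p => fderiv ℝ F p v :=
  (hF.fderiv_right (m := (⊤ : ℕ∞)) le_rfl).clm_apply contDiff_const

lemma ContDiff.dirDeriv {F : V → E} (hF : ContDiff ℝ (⊤ : ℕ∞) F) (l : List V) :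
    ContDiff ℝ (⊤ : ℕ∞) (dirDeriv l F) := by
  induction l with
  | nil => exact hF
  | cons v l ih => exact ih.fderiv_apply_const v

lemma fderiv_fderiv_apply_comm {F : V → E} (hF : ContDiff ℝ (⊤ : ℕ∞) F) (v w p : V) :
    fderiv ℝ (fun q => fderiv ℝ F q w) p v = fderiv ℝ (fun q => fderiv ℝ F q v) p w := by
  have hd : DifferentiableAt ℝ (fderiv ℝ F) p :=
    (hF.fderiv_right (m := (⊤ : ℕ∞)) le_rfl).differentiable (by simp) p
  rw [fderiv_clm_apply hd (differentiableAt_const w),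
    fderiv_clm_apply hd (differentiableAt_const v)]
  simpa using (hF.contDiffAt.isSymmSndFDerivAt (x := p)
    (by simp only [minSmoothness_of_isRCLikeNormedField]; exact WithTop.coe_le_coe.2 (le_top : (2 : ℕ∞) ≤ ⊤))).eq v w

lemma dirDeriv_perm {F : V → E} (hF : ContDiff ℝ (⊤ : ℕ∞) F) {l l' : List V}
    (h : l.Perm l') : dirDeriv l F = dirDeriv l' F := by
  induction h with
  | nil => rfl
  | cons v _ ih => exact congrArg (fun f p => fderiv ℝ f p v) ih
  | swap v w l =>
    funext p
    exact fderiv_fderiv_apply_comm (hF.dirDeriv l) w v p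
  | trans _ _ ih₁ ih₂ => exact ih₁.trans ih₂

lemma dirDeriv_append (l l' : List V) (F : V → E) :
    dirDeriv (l ++ l') F = dirDeriv l (dirDeriv l' F) :=
  List.foldr_append

lemma dirDeriv_comm {F : V → E} (hF : ContDiff ℝ (⊤ : ℕ∞) F) (l l' : List V) :
    dirDeriv l (dirDeriv l' F) = dirDeriv l' (dirDeriv l F) := by
  rw [← dirDeriv_append, ← dirDeriv_append]
  exact dirDeriv_perm hF List.perm_append_comm

end DirDeriv

variable {E : Type*} [NormedAddCommGroup E] [NormedSpace ℝ E]

lemma update_eq_add_single {R : Type*} [AddCommGroup R] (x : Fin n → R) (i : Fin n) (t : R) :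
    Function.update x i t = x + Pi.single i (t - x i) := by
  ext j
  by_cases h : j = i
  · subst h
    simp
  · simp [h]

lemma HasFDerivAt.pDeriv_eq {f : (Fin n → ℝ) → E} {f' : (Fin n → ℝ) →L[ℝ] E} {x : Fin n → ℝ}
    (h : HasFDerivAt f f' x) (i : Fin n) : pDeriv i f x = f' (Pi.single i 1) := by
  have hu : HasDerivAt (Function.update x i) (Pi.single i 1) (x i) := hasDerivAt_update x i (x i)
  have h' : HasFDerivAt f f' (Function.update x i (x i)) := by rwa [Function.update_eq_self]
  exact (h'.comp_hasDerivAt (x i) hu).deriv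

/-- Partial derivatives along an affine parametrization are directional derivatives. -/
lemma listDeriv_comp_eq_dirDeriv {V : Type*} [NormedAddCommGroup V] [NormedSpace ℝ V]
    {F : V → E} (hF : ContDiff ℝ (⊤ : ℕ∞) F) {j : (Fin n → ℝ) → V} {J : (Fin n → ℝ) →L[ℝ] V}
    (hj : ∀ x, HasFDerivAt j J x) (L : List (Fin n)) :
    listDeriv L (fun x => F (j x)) =
      fun x => dirDeriv (L.map fun i => J (Pi.single i 1)) F (j x) := by
  induction L with
  | nil => rfl
  | cons i L ih =>
    funext x
    change pDeriv i (listDeriv L fun x => F (j x)) x = _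
    rw [ih]
    have hd := ((hF.dirDeriv (L.map fun i => J (Pi.single i 1))).differentiable (by simp)
      (j x)).hasFDerivAt
    exact (hd.comp x (hj x)).pDeriv_eq i

lemma listDeriv_eq_dirDeriv {f : (Fin n → ℝ) → E} (hf : ContDiff ℝ (⊤ : ℕ∞) f)
    (L : List (Fin n)) :
    listDeriv L f = dirDeriv (L.map fun i => (Pi.single i 1 : Fin n → ℝ)) f :=
  listDeriv_comp_eq_dirDeriv hf (fun x => hasFDerivAt_id x) L

lemma ContDiff.listDeriv {f : (Fin n → ℝ) → E} (hf : ContDiff ℝ (⊤ : ℕ∞) f)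
    (L : List (Fin n)) : ContDiff ℝ (⊤ : ℕ∞) (listDeriv L f) := by
  rw [listDeriv_eq_dirDeriv hf]
  exact hf.dirDeriv _

lemma listDeriv_perm {f : (Fin n → ℝ) → E} (hf : ContDiff ℝ (⊤ : ℕ∞) f)
    {L L' : List (Fin n)} (h : L.Perm L') : listDeriv L f = listDeriv L' f := by
  rw [listDeriv_eq_dirDeriv hf, listDeriv_eq_dirDeriv hf, dirDeriv_perm hf (h.map _)]

lemma listDeriv_append (L L' : List (Fin n)) (f : (Fin n → ℝ) → E) :
    listDeriv (L ++ L') f = listDeriv L (listDeriv L' f) :=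
  List.foldr_append

lemma ContDiff.pDeriv {f : (Fin n → ℝ) → E} (hf : ContDiff ℝ (⊤ : ℕ∞) f) (i : Fin n) :
    ContDiff ℝ (⊤ : ℕ∞) (pDeriv i f) :=
  hf.listDeriv [i]

lemma pDeriv_sub {f g : (Fin n → ℝ) → E} (hf : ContDiff ℝ (⊤ : ℕ∞) f)
    (hg : ContDiff ℝ (⊤ : ℕ∞) g) (i : Fin n) :
    pDeriv i (f - g) = pDeriv i f - pDeriv i g := by
  funext x
  have h₁ := (hf.differentiable (by simp) x).hasFDerivAt
  have h₂ := (hg.differentiable (by simp) x).hasFDerivAt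
  rw [(h₁.sub h₂).pDeriv_eq, Pi.sub_apply, h₁.pDeriv_eq, h₂.pDeriv_eq]
  rfl

lemma listDeriv_sub {f g : (Fin n → ℝ) → E} (hf : ContDiff ℝ (⊤ : ℕ∞) f)
    (hg : ContDiff ℝ (⊤ : ℕ∞) g) (L : List (Fin n)) :
    listDeriv L (f - g) = listDeriv L f - listDeriv L g := by
  induction L with
  | nil => rfl
  | cons i L ih =>
    change pDeriv i (listDeriv L (f - g)) = pDeriv i (listDeriv L f) - pDeriv i (listDeriv L g)
    rw [ih, pDeriv_sub (hf.listDeriv L) (hg.listDeriv L)]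

lemma pDeriv_comp_add_const {f : (Fin n → ℝ) → E} (hf : ContDiff ℝ (⊤ : ℕ∞) f)
    (v : Fin n → ℝ) (i : Fin n) :
    pDeriv i (fun x => f (x + v)) = fun x => pDeriv i f (x + v) := by
  funext x
  have h₁ := (hf.differentiable (by simp) (x + v)).hasFDerivAt
  rw [h₁.pDeriv_eq, ((hasFDerivAt_comp_add_right v).2 h₁).pDeriv_eq]

lemma fwdDiffInt_apply (i : Fin n) {G : Type*} [AddCommGroup G] (g : (Fin n → ℤ) → G)
    (ξ : Fin n → ℤ) : fwdDiffInt i g ξ = g (ξ + Pi.single i 1) - g ξ := by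
  rw [fwdDiffInt, update_eq_add_single, add_sub_cancel_left]

lemma contDiff_listDiff {G : (Fin n → ℤ) → (Fin n → ℝ) → E}
    (hG : ∀ η, ContDiff ℝ (⊤ : ℕ∞) (G η)) (L : List (Fin n)) (η : Fin n → ℤ) :
    ContDiff ℝ (⊤ : ℕ∞) (listDiff L G η) := by
  induction L generalizing η with
  | nil => exact hG η
  | cons i L ih => exact (ih _).sub (ih _)

lemma listDeriv_listDiff {G : (Fin n → ℤ) → (Fin n → ℝ) → E}
    (hG : ∀ η, ContDiff ℝ (⊤ : ℕ∞) (G η)) (K L : List (Fin n)) (η : Fin n → ℤ)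
    (x : Fin n → ℝ) :
    listDeriv K (listDiff L G η) x = listDiff L (fun η => listDeriv K (G η) x) η := by
  induction L generalizing η with
  | nil => rfl
  | cons i L ih =>
    have h := listDeriv_sub (contDiff_listDiff hG L (Function.update η i (η i + 1)))
      (contDiff_listDiff hG L η) K
    refine (congrFun h x).trans ?_
    rw [Pi.sub_apply, ih, ih]
    rfl

end Derivatives

section Restriction

variable {n : ℕ} {E : Type*} [NormedAddCommGroup E] [NormedSpace ℝ E]

lemma latticePoint_add_single (η : Fin n → ℤ) (i : Fin n) :
    latticePoint (η + Pi.single i 1) = latticePoint η + Pi.single i 1 := by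
  ext j
  by_cases h : j = i
  · subst h
    simp [latticePoint]
  · simp [latticePoint, h]

/-- Iterated unit-step forward differences of functions on `ℝⁿ` along a list of indices. -/
def listRealDiff {F : Type*} [AddCommGroup F] (L : List (Fin n)) (f : (Fin n → ℝ) → F) :
    (Fin n → ℝ) → F :=
  L.foldr (fun i g ξ => g (ξ + Pi.single i 1) - g ξ) f

lemma listDiff_comp_latticePoint {F : Type*} [NormedAddCommGroup F] (L : List (Fin n))
    (f : (Fin n → ℝ) → F) :
    listDiff L (fun η => f (latticePoint η)) = fun η => listRealDiff L f (latticePoint η) := by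
  induction L with
  | nil => rfl
  | cons i L ih =>
    funext η
    change fwdDiffInt i (listDiff L fun η => f (latticePoint η)) η = _
    rw [ih, fwdDiffInt_apply, latticePoint_add_single]
    rfl

lemma ContDiff.listRealDiff {f : (Fin n → ℝ) → E} (hf : ContDiff ℝ (⊤ : ℕ∞) f)
    (L : List (Fin n)) : ContDiff ℝ (⊤ : ℕ∞) (listRealDiff L f) := by
  induction L with
  | nil => exact hf
  | cons i L ih => exact (ih.comp (contDiff_id.add contDiff_const)).sub ih

lemma pDeriv_listRealDiff {f : (Fin n → ℝ) → E} (hf : ContDiff ℝ (⊤ : ℕ∞) f) (i : Fin n)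
    (L : List (Fin n)) : pDeriv i (listRealDiff L f) = listRealDiff L (pDeriv i f) := by
  induction L with
  | nil => rfl
  | cons k L ih =>
    have h := hf.listRealDiff L
    have h' : ContDiff ℝ (⊤ : ℕ∞) fun ξ => listRealDiff L f (ξ + Pi.single k 1) :=
      h.comp (contDiff_id.add contDiff_const)
    refine (pDeriv_sub h' h i).trans ?_
    rw [pDeriv_comp_add_const h, ih]
    rfl

lemma norm_sub_le_of_norm_pDeriv_le {f : (Fin n → ℝ) → E} (hf : ContDiff ℝ (⊤ : ℕ∞) f)
    (i : Fin n) (ξ : Fin n → ℝ) {C : ℝ}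
    (h : ∀ t : ℝ, |t| ≤ 1 → ‖pDeriv i f (ξ + Pi.single i t)‖ ≤ C) :
    ‖f (ξ + Pi.single i 1) - f ξ‖ ≤ C := by
  have hd : ∀ t : ℝ, HasDerivAt (fun t => f (ξ + Pi.single i t))
      (pDeriv i f (ξ + Pi.single i t)) t := by
    intro t
    have hf' := (hf.differentiable (by simp) (ξ + Pi.single i t)).hasFDerivAt
    rw [hf'.pDeriv_eq]
    exact hf'.comp_hasDerivAt t ((hasDerivAt_single i t).const_add ξ)
  have := norm_image_sub_le_of_norm_deriv_le_segment_01' (C := C)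
    (fun t _ => (hd t).hasDerivWithinAt)
    (fun t ht => h t (abs_le.2 ⟨by linarith [ht.1], ht.2.le⟩))
  simpa using this

lemma norm_listRealDiff_le {r c : ℝ} (L : List (Fin n)) {f : (Fin n → ℝ) → E}
    (hf : ContDiff ℝ (⊤ : ℕ∞) f) (h : ∀ ξ, ‖listDeriv L f ξ‖ ≤ c * japSq ξ ^ r)
    (ξ : Fin n → ℝ) :
    ‖listRealDiff L f ξ‖ ≤ c * ((4 : ℝ) ^ |r|) ^ L.length * japSq ξ ^ r := by
  have hc : 0 ≤ c := nonneg_of_mul_nonneg_left ((norm_nonneg _).trans (h ξ))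
    (Real.rpow_pos_of_pos (japSq_pos ξ) r)
  induction L generalizing f ξ with
  | nil =>
    rw [List.length_nil, pow_zero, mul_one]
    exact h ξ
  | cons i L ih =>
    refine norm_sub_le_of_norm_pDeriv_le (hf.listRealDiff L) i ξ fun t ht => ?_
    rw [pDeriv_listRealDiff hf]
    have h' : ∀ ξ, ‖listDeriv L (pDeriv i f) ξ‖ ≤ c * japSq ξ ^ r := by
      intro ξ
      have : listDeriv L (pDeriv i f) = listDeriv (i :: L) f := by
        rw [← listDeriv_perm hf (List.perm_append_singleton i L), listDeriv_append]
        rfl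
      rw [this]
      exact h ξ
    refine (ih (hf.pDeriv i) h' _).trans ?_
    rw [List.length_cons, pow_succ, ← mul_assoc c, mul_assoc (c * _)]
    gcongr
    exact japSq_add_single_rpow_le ξ i ht r

variable {a : (Fin n → ℝ) → (Fin n → ℝ) → E}

lemma listDeriv_left_eq_dirDeriv
    (ha : ContDiff ℝ (⊤ : ℕ∞) fun p : (Fin n → ℝ) × (Fin n → ℝ) => a p.1 p.2)
    (L : List (Fin n)) (x ξ : Fin n → ℝ) :
    listDeriv L (fun x' => a x' ξ) x =
      dirDeriv (L.map fun i => ((Pi.single i 1 : Fin n → ℝ), (0 : Fin n → ℝ)))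
        (fun p => a p.1 p.2) (x, ξ) :=
  congrFun (listDeriv_comp_eq_dirDeriv ha (fun x => hasFDerivAt_prodMk_left x ξ) L) x

lemma listDeriv_right_eq_dirDeriv
    (ha : ContDiff ℝ (⊤ : ℕ∞) fun p : (Fin n → ℝ) × (Fin n → ℝ) => a p.1 p.2)
    (L : List (Fin n)) (x ξ : Fin n → ℝ) :
    listDeriv L (a x) ξ =
      dirDeriv (L.map fun i => ((0 : Fin n → ℝ), (Pi.single i 1 : Fin n → ℝ)))
        (fun p => a p.1 p.2) (x, ξ) :=
  congrFun (listDeriv_comp_eq_dirDeriv ha (fun ξ => hasFDerivAt_prodMk_right x ξ) L) ξ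

lemma contDiff_listDeriv_left
    (ha : ContDiff ℝ (⊤ : ℕ∞) fun p : (Fin n → ℝ) × (Fin n → ℝ) => a p.1 p.2)
    (L : List (Fin n)) :
    ContDiff ℝ (⊤ : ℕ∞)
      fun p : (Fin n → ℝ) × (Fin n → ℝ) => listDeriv L (fun x' => a x' p.2) p.1 := by
  simp only [listDeriv_left_eq_dirDeriv ha]
  exact ha.dirDeriv _

lemma mixedDeriv_eq_listDeriv_listDeriv
    (ha : ContDiff ℝ (⊤ : ℕ∞) fun p : (Fin n → ℝ) × (Fin n → ℝ) => a p.1 p.2)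
    (β α : Fin n → ℕ) (x ξ : Fin n → ℝ) :
    mixedDeriv β α a x ξ =
      listDeriv (indexList α) (fun ξ' => listDeriv (indexList β) (fun x' => a x' ξ') x) ξ := by
  rw [listDeriv_right_eq_dirDeriv
    (a := fun x ξ => listDeriv (indexList β) (fun x' => a x' ξ) x)
    (contDiff_listDeriv_left ha (indexList β))]
  simp only [mixedDeriv, mDeriv_eq_listDeriv, listDeriv_right_eq_dirDeriv ha,
    listDeriv_left_eq_dirDeriv ha]
  rw [listDeriv_left_eq_dirDeriv (a := fun x ξ => dirDeriv _ (fun p => a p.1 p.2) (x, ξ))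
    (ha.dirDeriv _)]
  exact congrFun (dirDeriv_comm ha _ _) (x, ξ)

/-- The restriction of a Euclidean symbol to the lattice satisfies the toroidal estimates. -/
lemma toroidal_estimate_of_euclidean
    (ha : ContDiff ℝ (⊤ : ℕ∞) fun p : (Fin n → ℝ) × (Fin n → ℝ) => a p.1 p.2)
    {α β : Fin n → ℕ} {r c : ℝ} (h : ∀ x ξ, ‖mixedDeriv β α a x ξ‖ ≤ c * japSq ξ ^ r)
    (x : Fin n → ℝ) (η : Fin n → ℤ) :
    ‖mFwdDiff α (fun η' => mDeriv β (fun x' => a x' (latticePoint η')) x) η‖ ≤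
      c * ((4 : ℝ) ^ |r|) ^ (indexList α).length * japSq (latticePoint η) ^ r := by
  have hs : ContDiff ℝ (⊤ : ℕ∞) fun ξ => listDeriv (indexList β) (fun x' => a x' ξ) x :=
    (contDiff_listDeriv_left ha (indexList β)).comp (contDiff_prodMk_right x)
  simp only [mFwdDiff_eq_listDiff, mDeriv_eq_listDeriv]
  rw [listDiff_comp_latticePoint (f := fun ξ => listDeriv (indexList β) (fun x' => a x' ξ) x)]
  refine norm_listRealDiff_le _ hs (fun ξ => ?_) _
  rw [← mixedDeriv_eq_listDeriv_listDeriv ha]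
  exact h x ξ

end Restriction

section Interpolation

variable {n : ℕ}

/-- Tensor products of one-dimensional interpolation kernels. -/
noncomputable def tensorKernel (γ : Fin n → ℕ) (t : Fin n → ℝ) : ℂ :=
  ∏ i, interpKernel (γ i) (t i)

lemma tensorKernel_zero_latticePoint (k : Fin n → ℤ) :
    tensorKernel 0 (latticePoint k) = if k = 0 then 1 else 0 := by
  simp only [tensorKernel, latticePoint, Pi.zero_apply, interpKernel_zero_int]
  split_ifs with h
  · simp [h]
  · obtain ⟨i, hi⟩ := Function.ne_iff.1 h
    exact Finset.prod_eq_zero (Finset.mem_univ i) (if_neg hi)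

lemma tensorKernel_decay (γ : Fin n → ℕ) (N : ℕ) :
    ∃ C : ℝ, 0 ≤ C ∧ ∀ t, ‖tensorKernel γ t‖ ≤ C * japSq t ^ (-(N : ℝ)) := by
  choose c hc h using fun i => interpKernel_decay (γ i) N
  refine ⟨∏ i, c i, Finset.prod_nonneg fun i _ => hc i, fun t => ?_⟩
  rw [tensorKernel, norm_prod]
  calc ∏ i, ‖interpKernel (γ i) (t i)‖
      ≤ ∏ i, c i * ((1 + t i ^ 2) ^ N)⁻¹ :=
        Finset.prod_le_prod (fun i _ => norm_nonneg _) fun i _ => h i (t i)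
    _ = (∏ i, c i) * ((∏ i, (1 + t i ^ 2)) ^ N)⁻¹ := by
        rw [Finset.prod_mul_distrib, Finset.prod_inv_distrib, Finset.prod_pow]
    _ ≤ (∏ i, c i) * japSq t ^ (-(N : ℝ)) := by
        rw [Real.rpow_neg (japSq_pos t).le, Real.rpow_natCast]
        have := japSq_pos t
        gcongr
        · exact Finset.prod_nonneg fun i _ => hc i
        · exact japSq_le_prod t

lemma tensorKernel_update (γ : Fin n → ℕ) (t : Fin n → ℝ) (i : Fin n) (k : ℕ) (s : ℝ) :
    tensorKernel (Function.update γ i k) (Function.update t i s) =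
      (∏ j ∈ Finset.univ.erase i, interpKernel (γ j) (t j)) * interpKernel k s := by
  rw [tensorKernel, ← Finset.prod_erase_mul _ _ (Finset.mem_univ i)]
  congr 1
  · refine Finset.prod_congr rfl fun j hj => ?_
    rw [Function.update_of_ne (Finset.ne_of_mem_erase hj),
      Function.update_of_ne (Finset.ne_of_mem_erase hj)]
  · simp

lemma hasFDerivAt_tensorKernel (γ : Fin n → ℕ) (t : Fin n → ℝ) :
    HasFDerivAt (tensorKernel γ)
      (∑ i, (ContinuousLinearMap.proj i : (Fin n → ℝ) →L[ℝ] ℝ).smulRight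
        (tensorKernel (Function.update γ i (γ i + 1)) (t + Pi.single i 1) -
          tensorKernel (Function.update γ i (γ i + 1)) t)) t := by
  have h : ∀ i ∈ (Finset.univ : Finset (Fin n)),
      HasFDerivAt (fun t : Fin n → ℝ => interpKernel (γ i) (t i))
        ((ContinuousLinearMap.proj i : (Fin n → ℝ) →L[ℝ] ℝ).smulRight
          (interpKernel (γ i + 1) (t i + 1) - interpKernel (γ i + 1) (t i))) t := by
    intro i _
    have h₁ := (hasDerivAt_interpKernel (γ i) (t i)).hasFDerivAt
    have h₂ := (ContinuousLinearMap.proj (R := ℝ) (φ := fun _ : Fin n => ℝ) i).hasFDerivAt (x := t)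
    convert! h₁.comp t h₂ using 1
  refine (HasFDerivAt.finsetProd h).congr_fderiv (Finset.sum_congr rfl fun i _ => ?_)
  have h₁ : t + Pi.single i 1 = Function.update t i (t i + 1) := by
    rw [update_eq_add_single, add_sub_cancel_left]
  have h₂ : tensorKernel (Function.update γ i (γ i + 1)) t =
      tensorKernel (Function.update γ i (γ i + 1)) (Function.update t i (t i)) := by
    rw [Function.update_eq_self]
  rw [h₁, h₂, tensorKernel_update, tensorKernel_update, ← mul_sub]
  ext v
  simp only [smul_apply, ContinuousLinearMap.smulRight_apply, smul_eq_mul,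
    Complex.real_smul]
  ring

/-- Families of smooth functions indexed by `ℤⁿ` all of whose derivatives are bounded, with
polynomial growth in the index. -/
structure ModerateFamily (G : (Fin n → ℤ) → (Fin n → ℝ) → ℂ) : Prop where
  contDiff : ∀ η, ContDiff ℝ (⊤ : ℕ∞) (G η)
  growth : ∀ L : List (Fin n), ∃ (C : ℝ) (N : ℕ), 0 ≤ C ∧
    ∀ η x, ‖listDeriv L (G η) x‖ ≤ C * japSq (latticePoint η) ^ (N : ℝ)

namespace ModerateFamily

variable {G : (Fin n → ℤ) → (Fin n → ℝ) → ℂ}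

protected lemma pDeriv (hG : ModerateFamily G) (i : Fin n) :
    ModerateFamily fun η => pDeriv i (G η) where
  contDiff η := (hG.contDiff η).pDeriv i
  growth L := by
    obtain ⟨C, N, hC, h⟩ := hG.growth (L ++ [i])
    refine ⟨C, N, hC, fun η x => ?_⟩
    have := h η x
    rwa [listDeriv_append] at this

protected lemma listDeriv (hG : ModerateFamily G) (L : List (Fin n)) :
    ModerateFamily fun η => listDeriv L (G η) := by
  induction L with
  | nil => exact hG
  | cons i L ih => exact ih.pDeriv i

protected lemma fwdDiffInt (hG : ModerateFamily G) (i : Fin n) :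
    ModerateFamily (fwdDiffInt i G) where
  contDiff := contDiff_listDiff hG.contDiff [i]
  growth L := by
    obtain ⟨C, N, hC, h⟩ := hG.growth L
    refine ⟨C * 4 ^ |(N : ℝ)| + C, N, by positivity, fun η x => ?_⟩
    rw [fwdDiffInt_apply, listDeriv_sub (hG.contDiff _) (hG.contDiff _), Pi.sub_apply, add_mul]
    refine (norm_sub_le _ _).trans (add_le_add ((h _ x).trans ?_) (h η x))
    rw [latticePoint_add_single, mul_assoc]
    gcongr
    exact japSq_add_single_rpow_le _ i (by simp) _

protected lemma listDiff (hG : ModerateFamily G) (L : List (Fin n)) :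
    ModerateFamily (listDiff L G) := by
  induction L with
  | nil => exact hG
  | cons i L ih => exact ih.fwdDiffInt i

/-- Uniform bounds on the terms of the interpolation series for `ξ` in a bounded set. -/
lemma exists_norm_tensorKernel_mul_le (hG : ModerateFamily G) (γ : Fin n → ℕ) (R : ℝ) :
    ∃ C : ℝ, 0 ≤ C ∧ ∀ ξ : Fin n → ℝ, japSq ξ ≤ R → ∀ η x,
      ‖tensorKernel γ (ξ - latticePoint η) * G η x‖ ≤
        C * japSq (latticePoint η) ^ (-(n : ℝ)) := by
  obtain ⟨C, N, hC, h⟩ := hG.growth []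
  obtain ⟨D, hD, hk⟩ := tensorKernel_decay γ (N + n)
  have hM : (0 : ℝ) ≤ ((N + n : ℕ) : ℝ) := Nat.cast_nonneg _
  refine ⟨D * (2 * |R|) ^ ((N + n : ℕ) : ℝ) * C, by positivity, fun ξ hξ η x => ?_⟩
  have hJ := japSq_pos (latticePoint η)
  have hR : japSq ξ ≤ |R| := hξ.trans (le_abs_self R)
  have hξ0 := japSq_pos ξ
  have h₁ : japSq (ξ - latticePoint η) ^ (-((N + n : ℕ) : ℝ)) ≤
      (2 * |R|) ^ ((N + n : ℕ) : ℝ) * japSq (latticePoint η) ^ (-((N + n : ℕ) : ℝ)) := by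
    have := japSq_add_rpow_le (-latticePoint η) ξ (-((N + n : ℕ) : ℝ))
    rw [japSq_neg, neg_add_eq_sub, abs_neg, abs_of_nonneg hM] at this
    refine this.trans ?_
    gcongr
  have h₂ : japSq (latticePoint η) ^ (-((N + n : ℕ) : ℝ)) * japSq (latticePoint η) ^ (N : ℝ) =
      japSq (latticePoint η) ^ (-(n : ℝ)) := by
    rw [← Real.rpow_add hJ]
    congr 1
    push_cast
    ring
  rw [norm_mul]
  calc ‖tensorKernel γ (ξ - latticePoint η)‖ * ‖G η x‖
      ≤ (D * ((2 * |R|) ^ ((N + n : ℕ) : ℝ) *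
          japSq (latticePoint η) ^ (-((N + n : ℕ) : ℝ)))) *
          (C * japSq (latticePoint η) ^ (N : ℝ)) := by
        refine mul_le_mul ((hk _).trans ?_) (h η x) (norm_nonneg _) (by positivity)
        gcongr
    _ = D * (2 * |R|) ^ ((N + n : ℕ) : ℝ) * C * japSq (latticePoint η) ^ (-(n : ℝ)) := by
        rw [← h₂]
        ring

lemma summable_tensorKernel_mul (hG : ModerateFamily G) (γ : Fin n → ℕ) (ξ x : Fin n → ℝ) :
    Summable fun η => tensorKernel γ (ξ - latticePoint η) * G η x := by
  obtain ⟨C, -, h⟩ := hG.exists_norm_tensorKernel_mul_le γ (japSq ξ)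
  exact .of_norm_bounded (summable_japSq_lattice.mul_left C) fun η => h ξ le_rfl η x

end ModerateFamily

/-- The interpolation `∑_η Φ_γ(ξ - η) G_η(x)` of a family of functions. -/
noncomputable def interp (γ : Fin n → ℕ) (G : (Fin n → ℤ) → (Fin n → ℝ) → ℂ)
    (p : (Fin n → ℝ) × (Fin n → ℝ)) : ℂ :=
  ∑' η, tensorKernel γ (p.2 - latticePoint η) * G η p.1

/-- The `i`-th coordinate of the first component. -/
noncomputable def fstCoord (i : Fin n) : (Fin n → ℝ) × (Fin n → ℝ) →L[ℝ] ℝ :=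
  (ContinuousLinearMap.proj i).comp (ContinuousLinearMap.fst ℝ _ _)

/-- The `i`-th coordinate of the second component. -/
noncomputable def sndCoord (i : Fin n) : (Fin n → ℝ) × (Fin n → ℝ) →L[ℝ] ℝ :=
  (ContinuousLinearMap.proj i).comp (ContinuousLinearMap.snd ℝ _ _)

lemma hasFDerivAt_eq_sum_pDeriv {f : (Fin n → ℝ) → ℂ} (hf : ContDiff ℝ (⊤ : ℕ∞) f)
    (x : Fin n → ℝ) :
    HasFDerivAt f
      (∑ i, (ContinuousLinearMap.proj i : (Fin n → ℝ) →L[ℝ] ℝ).smulRight (pDeriv i f x)) x := by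
  have h := (hf.differentiable (by simp) x).hasFDerivAt
  refine h.congr_fderiv ?_
  ext v
  simp only [h.pDeriv_eq, sum_apply, ContinuousLinearMap.smulRight_apply,
    ContinuousLinearMap.proj_apply]
  conv_lhs => rw [pi_eq_sum_univ' v, map_sum]
  refine Finset.sum_congr rfl fun i _ => ?_
  rw [map_smul]

lemma hasFDerivAt_tensorKernel_mul (γ : Fin n → ℕ) {f : (Fin n → ℝ) → ℂ}
    (hf : ContDiff ℝ (⊤ : ℕ∞) f) (v : Fin n → ℝ) (p : (Fin n → ℝ) × (Fin n → ℝ)) :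
    HasFDerivAt (fun p : (Fin n → ℝ) × (Fin n → ℝ) => tensorKernel γ (p.2 - v) * f p.1)
      ((∑ i, (fstCoord i).smulRight (tensorKernel γ (p.2 - v) * pDeriv i f p.1)) +
        ∑ i, (sndCoord i).smulRight
          (tensorKernel (Function.update γ i (γ i + 1)) (p.2 + Pi.single i 1 - v) * f p.1 -
            tensorKernel (Function.update γ i (γ i + 1)) (p.2 - v) * f p.1)) p := by
  have h₁ := (hasFDerivAt_tensorKernel γ (p.2 - v)).comp p
    ((hasFDerivAt_snd (𝕜 := ℝ) (p := p)).sub_const v)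
  have h₂ := (hasFDerivAt_eq_sum_pDeriv hf p.1).comp p (hasFDerivAt_fst (𝕜 := ℝ) (p := p))
  refine (h₁.mul h₂).congr_fderiv ?_
  ext w
  · simp [fstCoord, sndCoord, Finset.mul_sum, add_sub_right_comm]
    exact Finset.sum_congr rfl fun i _ => by ring
  · simp [fstCoord, sndCoord, Finset.mul_sum, add_sub_right_comm]
    exact Finset.sum_congr rfl fun i _ => by ring

namespace ModerateFamily

variable {G : (Fin n → ℤ) → (Fin n → ℝ) → ℂ}

lemma hasSum_interp (hG : ModerateFamily G) (γ : Fin n → ℕ) (p : (Fin n → ℝ) × (Fin n → ℝ)) :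
    HasSum (fun η => tensorKernel γ (p.2 - latticePoint η) * G η p.1) (interp γ G p) :=
  (hG.summable_tensorKernel_mul γ p.2 p.1).hasSum

/-- Summation by parts. -/
lemma hasSum_interp_fwdDiffInt (hG : ModerateFamily G) (γ : Fin n → ℕ) (i : Fin n)
    (p : (Fin n → ℝ) × (Fin n → ℝ)) :
    HasSum (fun η => tensorKernel γ (p.2 + Pi.single i 1 - latticePoint η) * G η p.1 -
      tensorKernel γ (p.2 - latticePoint η) * G η p.1) (interp γ (fwdDiffInt i G) p) := by
  have h₁ := hG.hasSum_interp γ (p.1, p.2 + Pi.single i 1)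
  have h₂ := hG.hasSum_interp γ p
  have h₃ : HasSum (fun η => tensorKernel γ (p.2 - latticePoint η) * fwdDiffInt i G η p.1)
      (interp γ G (p.1, p.2 + Pi.single i 1) - interp γ G p) := by
    refine (((Equiv.addRight (Pi.single i 1 : Fin n → ℤ)).hasSum_iff.2 h₁).sub h₂).congr_fun
      fun η => ?_
    simp only [Function.comp_apply, Equiv.coe_addRight, fwdDiffInt_apply, Pi.sub_apply,
      latticePoint_add_single, add_sub_add_right_eq_sub, mul_sub]
  rw [((hG.fwdDiffInt i).hasSum_interp γ p).unique h₃]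
  exact h₁.sub h₂

lemma hasFDerivAt_interp (hG : ModerateFamily G) (γ : Fin n → ℕ)
    (p : (Fin n → ℝ) × (Fin n → ℝ)) :
    HasFDerivAt (interp γ G)
      ((∑ i, (fstCoord i).smulRight (interp γ (fun η => pDeriv i (G η)) p)) +
        ∑ i, (sndCoord i).smulRight
          (interp (Function.update γ i (γ i + 1)) (fwdDiffInt i G) p)) p := by
  set R : ℝ := 2 * (1 + n) * japSq p.2 with hR
  have hR0 : 0 ≤ R := by
    have := japSq_pos p.2
    positivity
  have hball : ∀ q ∈ Metric.ball p 1, japSq q.2 ≤ R := by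
    intro q hq
    have h₁ : ∀ i, |q.2 i - p.2 i| ≤ 1 := fun i => by
      have := (norm_le_pi_norm (q - p).2 i).trans ((norm_snd_le (q - p)).trans
        (mem_ball_iff_norm.1 hq).le)
      simpa using this
    have h₂ : japSq (q.2 - p.2) ≤ 1 + n := by
      unfold japSq
      gcongr
      calc ∑ i, (q.2 - p.2) i ^ 2 ≤ ∑ _i : Fin n, (1 : ℝ) :=
            Finset.sum_le_sum fun i _ => (sq_le_one_iff_abs_le_one _).2 (h₁ i)
        _ = n := by simp
    have h₃ := japSq_add_le p.2 (q.2 - p.2)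
    rw [add_sub_cancel] at h₃
    refine h₃.trans ?_
    have := japSq_pos p.2
    rw [hR]
    gcongr
  have hshift : ∀ q ∈ Metric.ball p 1, ∀ i : Fin n, japSq (q.2 + Pi.single i 1) ≤ 4 * R := by
    intro q hq i
    have := japSq_add_single_rpow_le q.2 i (t := 1) (by simp) 1
    simp only [abs_one, Real.rpow_one] at this
    linarith [hball q hq]
  choose A hA0 hA using fun i =>
    (hG.pDeriv i).exists_norm_tensorKernel_mul_le γ R
  choose B hB0 hB using fun i =>
    hG.exists_norm_tensorKernel_mul_le (Function.update γ i (γ i + 1)) (4 * R)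
  have key := hasFDerivAt_tsum_of_isPreconnected (𝕜 := ℝ)
    (u := fun η : Fin n → ℤ => ((∑ i, ‖fstCoord i‖ * A i) + ∑ i, ‖sndCoord i‖ * (B i + B i)) *
      japSq (latticePoint η) ^ (-(n : ℝ)))
    (summable_japSq_lattice.mul_left _) Metric.isOpen_ball
    (convex_ball p 1).isPreconnected
    (fun η q _ => hasFDerivAt_tensorKernel_mul γ (hG.contDiff η) (latticePoint η) q)
    (fun η q hq => ?_) (Metric.mem_ball_self one_pos)
    (hG.summable_tensorKernel_mul γ p.2 p.1) (Metric.mem_ball_self one_pos)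
  · refine key.congr_fderiv (HasSum.tsum_eq ?_)
    refine (hasSum_sum fun i _ => ?_).add (hasSum_sum fun i _ => ?_)
    · exact (ContinuousLinearMap.smulRightL ℝ _ ℂ (fstCoord i)).hasSum
        ((hG.pDeriv i).hasSum_interp γ p)
    · exact (ContinuousLinearMap.smulRightL ℝ _ ℂ (sndCoord i)).hasSum
        (hG.hasSum_interp_fwdDiffInt (Function.update γ i (γ i + 1)) i p)
  · rw [add_mul, Finset.sum_mul, Finset.sum_mul]
    refine (norm_add_le _ _).trans (add_le_add (norm_sum_le_of_le _ fun i _ => ?_)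
      (norm_sum_le_of_le _ fun i _ => ?_))
    · rw [ContinuousLinearMap.norm_smulRight_apply, mul_assoc]
      gcongr
      exact hA i q.2 (hball q hq) η q.1
    · rw [ContinuousLinearMap.norm_smulRight_apply, mul_assoc, add_mul]
      gcongr
      refine (norm_sub_le _ _).trans (add_le_add ?_ ?_)
      · exact hB i _ (hshift q hq i) η q.1
      · exact hB i _ ((hball q hq).trans (by linarith)) η q.1

lemma contDiff_interp (hG : ModerateFamily G) (γ : Fin n → ℕ) :
    ContDiff ℝ (⊤ : ℕ∞) (interp γ G) := by
  rw [contDiff_infty]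
  intro k
  induction k generalizing γ G with
  | zero =>
    exact contDiff_zero.2 (continuous_iff_continuousAt.2 fun p =>
      (hG.hasFDerivAt_interp γ p).continuousAt)
  | succ k ih =>
    refine contDiff_succ_iff_hasFDerivAt.2 ⟨_, ?_, hG.hasFDerivAt_interp γ⟩
    refine (ContDiff.sum fun i _ => ?_).add (ContDiff.sum fun i _ => ?_)
    · exact (ContinuousLinearMap.smulRightL ℝ _ ℂ (fstCoord i)).contDiff.comp
        (ih (hG.pDeriv i) γ)
    · exact (ContinuousLinearMap.smulRightL ℝ _ ℂ (sndCoord i)).contDiff.comp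
        (ih (hG.fwdDiffInt i) _)

lemma listDeriv_interp_left (hG : ModerateFamily G) (γ : Fin n → ℕ) (L : List (Fin n))
    (ξ : Fin n → ℝ) :
    listDeriv L (fun x => interp γ G (x, ξ)) =
      fun x => interp γ (fun η => listDeriv L (G η)) (x, ξ) := by
  induction L with
  | nil => rfl
  | cons i L ih =>
    funext x
    change pDeriv i (listDeriv L fun x => interp γ G (x, ξ)) x = _
    rw [ih]
    refine ((((hG.listDeriv L).hasFDerivAt_interp γ (x, ξ)).comp x
      (hasFDerivAt_prodMk_left x ξ)).pDeriv_eq i).trans ?_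
    simp [fstCoord, sndCoord, sum_apply, Pi.single_apply]
    rfl

lemma exists_listDeriv_interp_right (γ : Fin n → ℕ) (L : List (Fin n)) :
    ∃ γ' : Fin n → ℕ, ∀ {G : (Fin n → ℤ) → (Fin n → ℝ) → ℂ}, ModerateFamily G →
      ∀ x, listDeriv L (fun ξ => interp γ G (x, ξ)) =
        fun ξ => interp γ' (listDiff L G) (x, ξ) := by
  induction L with
  | nil => exact ⟨γ, fun _ _ => rfl⟩
  | cons i L ih =>
    obtain ⟨γ', h⟩ := ih
    refine ⟨Function.update γ' i (γ' i + 1), fun hG x => ?_⟩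
    funext ξ
    change pDeriv i (listDeriv L _) ξ = _
    rw [h hG]
    refine ((((hG.listDiff L).hasFDerivAt_interp γ' (x, ξ)).comp ξ
      (hasFDerivAt_prodMk_right x ξ)).pDeriv_eq i).trans ?_
    simp [fstCoord, sndCoord, sum_apply, Pi.single_apply]
    rfl

end ModerateFamily

lemma interp_zero_latticePoint (G : (Fin n → ℤ) → (Fin n → ℝ) → ℂ) (x : Fin n → ℝ)
    (k : Fin n → ℤ) : interp 0 G (x, latticePoint k) = G k x := by
  have hsub : ∀ η, latticePoint k - latticePoint η = latticePoint (k - η) := by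
    intro η
    ext i
    simp [latticePoint]
  rw [interp, tsum_eq_single k]
  · rw [hsub, sub_self, tensorKernel_zero_latticePoint, if_pos rfl, one_mul]
  · intro η hη
    simp [hsub, tensorKernel_zero_latticePoint, sub_eq_zero, hη.symm]

/-- Interpolation preserves bounds by powers of the Japanese bracket. -/
lemma exists_norm_interp_le (γ : Fin n → ℕ) (s : ℝ) :
    ∃ C : ℝ, ∀ (G : (Fin n → ℤ) → (Fin n → ℝ) → ℂ) (c : ℝ) (x ξ : Fin n → ℝ),
      (∀ η, ‖G η x‖ ≤ c * japSq (latticePoint η) ^ s) →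
        ‖interp γ G (x, ξ)‖ ≤ c * C * japSq ξ ^ s := by
  obtain ⟨S, hS, hsum⟩ := exists_tsum_japSq_sub_le (n := n)
  obtain ⟨M, hM⟩ := exists_nat_ge |s|
  obtain ⟨D, hD, hk⟩ := tensorKernel_decay γ (M + n)
  refine ⟨D * 2 ^ |s| * S, fun G c x ξ h => ?_⟩
  have hc : 0 ≤ c := nonneg_of_mul_nonneg_left ((norm_nonneg _).trans (h 0))
    (Real.rpow_pos_of_pos (japSq_pos _) s)
  have hξ := japSq_pos ξ
  have hterm : ∀ η, ‖tensorKernel γ (ξ - latticePoint η) * G η x‖ ≤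
      c * (D * 2 ^ |s|) * japSq ξ ^ s * japSq (ξ - latticePoint η) ^ (-(n : ℝ)) := by
    intro η
    set t := ξ - latticePoint η with ht
    have hJ := japSq_pos t
    have h₁ : japSq (latticePoint η) ^ s ≤ (2 * japSq t) ^ |s| * japSq ξ ^ s := by
      have := japSq_add_rpow_le ξ (-t) s
      rwa [japSq_neg, ht, neg_sub, add_sub_cancel] at this
    have h₂ : japSq t ^ (-((M + n : ℕ) : ℝ)) * japSq t ^ |s| ≤ japSq t ^ (-(n : ℝ)) := by
      rw [← Real.rpow_add hJ]
      refine Real.rpow_le_rpow_of_exponent_le (one_le_japSq t) ?_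
      push_cast
      linarith
    rw [norm_mul]
    calc ‖tensorKernel γ t‖ * ‖G η x‖
        ≤ (D * japSq t ^ (-((M + n : ℕ) : ℝ))) * (c * ((2 * japSq t) ^ |s| * japSq ξ ^ s)) := by
          refine mul_le_mul (hk t) ((h η).trans ?_) (norm_nonneg _) (by positivity)
          gcongr
      _ = c * (D * 2 ^ |s|) * japSq ξ ^ s *
            (japSq t ^ (-((M + n : ℕ) : ℝ)) * japSq t ^ |s|) := by
          rw [Real.mul_rpow (by norm_num) hJ.le]
          ring
      _ ≤ c * (D * 2 ^ |s|) * japSq ξ ^ s * japSq t ^ (-(n : ℝ)) := by gcongr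
  refine (tsum_of_norm_bounded ((hsum ξ).1.mul_left _).hasSum hterm).trans ?_
  rw [tsum_mul_left]
  calc c * (D * 2 ^ |s|) * japSq ξ ^ s * ∑' η, japSq (ξ - latticePoint η) ^ (-(n : ℝ))
      ≤ c * (D * 2 ^ |s|) * japSq ξ ^ s * S := by
        have := (hsum ξ).2
        gcongr
    _ = c * (D * 2 ^ |s| * S) * japSq ξ ^ s := by ring

/-- The interpolation of a toroidal symbol satisfies the Euclidean estimates. -/
lemma ModerateFamily.euclidean_estimate_interp {G : (Fin n → ℤ) → (Fin n → ℝ) → ℂ}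
    (hG : ModerateFamily G) {α β : Fin n → ℕ} {s c : ℝ}
    (h : ∀ x η, ‖mFwdDiff α (fun η' => mDeriv β (G η') x) η‖ ≤ c * japSq (latticePoint η) ^ s) :
    ∃ c' : ℝ, ∀ x ξ,
      ‖mixedDeriv β α (fun x ξ => interp 0 G (x, ξ)) x ξ‖ ≤ c' * japSq ξ ^ s := by
  obtain ⟨γ, hγ⟩ := ModerateFamily.exists_listDeriv_interp_right 0 (indexList α)
  obtain ⟨C, hC⟩ := exists_norm_interp_le γ s
  refine ⟨c * C, fun x ξ => ?_⟩
  simp only [mixedDeriv, mDeriv_eq_listDeriv, hγ hG]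
  rw [(hG.listDiff (indexList α)).listDeriv_interp_left]
  refine hC _ c x ξ fun η => ?_
  rw [listDeriv_listDiff hG.contDiff]
  simpa only [mFwdDiff_eq_listDiff, mDeriv_eq_listDeriv] using h x η

end Interpolation

lemma moderateFamily_of_toroidal_estimate {n : ℕ} {m ρ δ : ℝ}
    {G : (Fin n → ℤ) → (Fin n → ℝ) → ℂ} (hG : ∀ η, ContDiff ℝ (⊤ : ℕ∞) (G η))
    (h : ∀ α β : Fin n → ℕ, ∃ c : ℝ, ∀ x η,
      ‖mFwdDiff α (fun η' => mDeriv β (G η') x) η‖ ≤ c * japSq (latticePoint η) ^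
        ((m - ρ * (∑ i, α i : ℝ) + δ * (∑ i, β i : ℝ)) / 2)) :
    ModerateFamily G where
  contDiff := hG
  growth L := by
    obtain ⟨c, hc⟩ := h 0 fun i => L.count i
    set s : ℝ := (m - ρ * (∑ i, ((0 : Fin n → ℕ) i : ℝ)) + δ * (∑ i, (L.count i : ℝ))) / 2
    obtain ⟨N, hN⟩ := exists_nat_ge s
    refine ⟨|c|, N, abs_nonneg c, fun η x => ?_⟩
    have h₀ : ∀ g : (Fin n → ℤ) → ℂ, mFwdDiff 0 g = g := by
      intro g
      have : indexList (0 : Fin n → ℕ) = [] := by simp [indexList]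
      rw [mFwdDiff_eq_listDiff, this]
      rfl
    have h₁ := hc x η
    rw [h₀, mDeriv_eq_listDeriv, listDeriv_perm (hG η) (perm_indexList_count L)] at h₁
    refine h₁.trans (mul_le_mul (le_abs_self c)
      (Real.rpow_le_rpow_of_exponent_le (one_le_japSq _) hN)
      (Real.rpow_nonneg (japSq_pos _).le _) (abs_nonneg c))

/-- Connection between two symbols: a function `ã : ℝⁿ × ℤⁿ → ℂ`,
1-periodic and smooth in `x` for each fixed `ξ ∈ ℤⁿ`, satisfies the toroidal symbol
estimates of class `S^m_{ρ,δ}` if and only if there exists a smooth Euclidean symbol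
`a : ℝⁿ × ℝⁿ → ℂ` of class `S^m_{ρ,δ}`, 1-periodic in `x`, with `ã = a|_{ℝⁿ×ℤⁿ}`. -/
theorem toroidal_euclidean_symbol_connection {n : ℕ} (m ρ δ : ℝ)
    (hρ : 0 < ρ) (hρ1 : ρ ≤ 1) (hδ : 0 ≤ δ) (hδ1 : δ ≤ 1)
    (atil : (Fin n → ℝ) → (Fin n → ℤ) → ℂ)
    (hper : ∀ (x : Fin n → ℝ) (ξ : Fin n → ℤ) (i : Fin n),
      atil (Function.update x i (x i + 1)) ξ = atil x ξ)
    (hsmooth : ∀ ξ : Fin n → ℤ, ContDiff ℝ (⊤ : ℕ∞) (fun x => atil x ξ)) :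
    (∀ α β : Fin n → ℕ, ∃ c : ℝ, ∀ (x : Fin n → ℝ) (ξ : Fin n → ℤ),
        ‖mFwdDiff α (fun ξ' => mDeriv β (fun x' => atil x' ξ') x) ξ‖ ≤
          c * (1 + ∑ i, (ξ i : ℝ) ^ 2) ^
            ((m - ρ * (∑ i, α i : ℝ) + δ * (∑ i, β i : ℝ)) / 2)) ↔
    (∃ a : (Fin n → ℝ) → (Fin n → ℝ) → ℂ,
      ContDiff ℝ (⊤ : ℕ∞) (fun p : (Fin n → ℝ) × (Fin n → ℝ) => a p.1 p.2) ∧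
      (∀ (x ξ : Fin n → ℝ) (i : Fin n), a (Function.update x i (x i + 1)) ξ = a x ξ) ∧
      (∀ α β : Fin n → ℕ, ∃ c : ℝ, ∀ x ξ : Fin n → ℝ,
        ‖mixedDeriv β α a x ξ‖ ≤
          c * (1 + ∑ i, ξ i ^ 2) ^
            ((m - ρ * (∑ i, α i : ℝ) + δ * (∑ i, β i : ℝ)) / 2)) ∧
      (∀ (x : Fin n → ℝ) (ξ : Fin n → ℤ), atil x ξ = a x (fun i => (ξ i : ℝ)))) := by
  constructor
  · intro h
    have hG : ModerateFamily fun η x => atil x η :=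
      moderateFamily_of_toroidal_estimate hsmooth h
    refine ⟨fun x ξ => interp 0 (fun η x => atil x η) (x, ξ), hG.contDiff_interp 0,
      fun x ξ i => ?_, fun α β => ?_, fun x ξ => ?_⟩
    · simp only [interp, hper]
    · obtain ⟨c, hc⟩ := h α β
      exact hG.euclidean_estimate_interp hc
    · exact (interp_zero_latticePoint (fun η x => atil x η) x ξ).symm
  · rintro ⟨a, ha, -, hest, hrestr⟩ α β
    obtain ⟨c, hc⟩ := hest α β
    simp only [hrestr]
    exact ⟨_, toroidal_estimate_of_euclidean ha hc⟩
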